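/- Let γ ∈ ℝ with sin γ ≠ 0 and n ≥ 1. For s, φ ∈ ℂ define the 2ⁿ×2ⁿ transfer matrix Ω(s,φ) = ⟨0| L₁(φ,s) L₂(φ,s) ⋯ Lₙ(φ,s) |0⟩, the matrix of vacuum (|0⟩) expectation values in the auxiliary space H_a of products of XXZ Lax operators. Then the family {Ω(s,φ)} is mutually commuting: [Ω(s,φ), Ω(s',φ')] = 0 for all s, s', φ, φ' ∈ ℂ. -/

import Mathlib

/- STATEMENT 4: the transfer matrices Ω(s,φ) built from XXZ Lax operators with
vacuum auxiliary boundary conditions form a mutually commuting family. -/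

noncomputable section

open Matrix Kronecker

/-- The auxiliary space: finitely supported functions ℕ → ℂ. -/
abbrev Ha : Type := ℕ →₀ ℂ

/-- The linear operator on `Ha` sending the basis vector `|l⟩` to `v l`. -/
def ofBasis (v : ℕ → Ha) : Ha →ₗ[ℂ] Ha :=
  Finsupp.lsum ℂ fun l => LinearMap.toSpanSingleton ℂ Ha (v l)

/-- The q-number `[x]_q = (q^x - q^{-x})/(q - q^{-1})` for `q = exp(iγ)`. -/
def qnum (γ : ℝ) (x : ℂ) : ℂ :=
  (Complex.exp (Complex.I * γ * x) - Complex.exp (-(Complex.I * γ * x))) /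
    (Complex.exp (Complex.I * γ) - Complex.exp (-(Complex.I * γ)))

/-- `s⁺ = Σ_{k≥0} [k+1]_q |k⟩⟨k+1|`. -/
def Sp (γ : ℝ) : Ha →ₗ[ℂ] Ha :=
  ofBasis fun l =>
    match l with
    | 0 => 0
    | k + 1 => qnum γ ((k : ℂ) + 1) • Finsupp.single k 1

/-- `s⁻_s = Σ_{k≥0} [2s-k]_q |k+1⟩⟨k|`. -/
def Sm (γ : ℝ) (s : ℂ) : Ha →ₗ[ℂ] Ha :=
  ofBasis fun k => qnum γ (2 * s - (k : ℂ)) • Finsupp.single (k + 1) 1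

/-- Diagonal operator `Σ_k c(k) |k⟩⟨k|` on the auxiliary space. -/
def diagOp (c : ℕ → ℂ) : Ha →ₗ[ℂ] Ha :=
  ofBasis fun k => c k • Finsupp.single k 1

/-- An operator on `ι → Ha` ≅ ℂ^ι ⊗ H_a given by a matrix of auxiliary-space
operators. -/
def matOp {ι : Type} [Fintype ι] (A : ι → ι → (Ha →ₗ[ℂ] Ha)) :
    (ι → Ha) →ₗ[ℂ] (ι → Ha) where
  toFun f i := ∑ j, A i j (f j)
  map_add' f g := by
    funext i
    simp [Finset.sum_add_distrib]
  map_smul' c f := by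
    funext i
    simp [Finset.smul_sum]

/-- The operator given by the 2×2 matrix `M` of auxiliary operators, acting on
the first physical ℂ² factor (and the auxiliary space). -/
def leg1 (M : Matrix (Fin 2) (Fin 2) (Ha →ₗ[ℂ] Ha)) :
    (Fin 2 × Fin 2 → Ha) →ₗ[ℂ] (Fin 2 × Fin 2 → Ha) :=
  matOp fun p q => if p.2 = q.2 then M p.1 q.1 else 0

/-- The operator given by the 2×2 matrix `M` of auxiliary operators, acting on
the second physical ℂ² factor (and the auxiliary space). -/
def leg2 (M : Matrix (Fin 2) (Fin 2) (Ha →ₗ[ℂ] Ha)) :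
    (Fin 2 × Fin 2 → Ha) →ₗ[ℂ] (Fin 2 × Fin 2 → Ha) :=
  matOp fun p q => if p.1 = q.1 then M p.2 q.2 else 0

/-- A purely physical operator (a 4×4 scalar matrix acting trivially on the
auxiliary space). -/
def physOp (A : Matrix (Fin 2 × Fin 2) (Fin 2 × Fin 2) ℂ) :
    (Fin 2 × Fin 2 → Ha) →ₗ[ℂ] (Fin 2 × Fin 2 → Ha) :=
  matOp fun p q => A p q • LinearMap.id

def pauliZ : Matrix (Fin 2) (Fin 2) ℂ := !![1, 0; 0, -1]
def pauliP : Matrix (Fin 2) (Fin 2) ℂ := !![0, 1; 0, 0]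
def pauliM : Matrix (Fin 2) (Fin 2) ℂ := !![0, 0; 1, 0]

/-- The local XXZ Hamiltonian density
`h = 2(σ⁺⊗σ⁻ + σ⁻⊗σ⁺) + Δ σ^z⊗σ^z` with `Δ = cos γ`. -/
def hXXZ (γ : ℝ) : Matrix (Fin 2 × Fin 2) (Fin 2 × Fin 2) ℂ :=
  (2 : ℂ) • (pauliP ⊗ₖ pauliM + pauliM ⊗ₖ pauliP)
    + (Real.cos γ : ℂ) • (pauliZ ⊗ₖ pauliZ)

/-- The XXZ Lax operator `L(φ,s)` as a 2×2 matrix of auxiliary-space operators. -/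
def LaxM (γ : ℝ) (φ s : ℂ) : Matrix (Fin 2) (Fin 2) (Ha →ₗ[ℂ] Ha) :=
  !![diagOp fun k => Complex.sin (φ + γ * (s - (k : ℂ))), (Real.sin γ : ℂ) • Sm γ s;
     (Real.sin γ : ℂ) • Sp γ, diagOp fun k => Complex.sin (φ - γ * (s - (k : ℂ)))]

/-- Vacuum (highest-weight `|0⟩`) expectation value `⟨0|A|0⟩` of an auxiliary
operator. -/
def vac (A : Ha →ₗ[ℂ] Ha) : ℂ := A (Finsupp.single 0 1) 0

/-- The transfer matrix `Ω(s,φ) = ⟨0| L₁(φ,s) L₂(φ,s) ⋯ Lₙ(φ,s) |0⟩`,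
a 2ⁿ×2ⁿ matrix whose entry between physical product basis states is the vacuum
expectation value of the ordered product of auxiliary operators. -/
def Omega (γ : ℝ) (n : ℕ) (s φ : ℂ) :
    Matrix (Fin n → Fin 2) (Fin n → Fin 2) ℂ :=
  fun σ τ =>
    vac ((List.ofFn fun j : Fin n =>
      (LaxM γ φ s (σ j) (τ j) : Module.End ℂ Ha)).prod)

section aux

def rse (c : ℕ → ℂ) (f : ℕ → ℂ) : ℕ → ℂ
  | 0 => 0
  | k + 1 => c k * f k

def lax (g u v : ℂ) (x y : Fin 2) (f : ℕ → ℂ) (k : ℕ) : ℂ :=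
  if x = 0 then
    (if y = 0 then Complex.sin (u - g * k) * f k
      else rse (fun k => Complex.sin (u - v - g * k)) f k)
  else
    (if y = 0 then Complex.sin (g * (k + 1)) * f (k + 1)
      else Complex.sin (v + g * k) * f k)

def MM (g u v u' v' : ℂ) (x y : Fin 2) (ψ : ℕ → ℕ → ℂ) (a b : ℕ) : ℂ :=
  ∑ r, lax g u v x r (fun p => lax g u' v' r y (ψ p) b) a

def TT (g u v u' v' : ℂ) : List (Fin 2 × Fin 2) → ℕ → ℕ → ℂ
  | [] => fun a b => if a = 0 ∧ b = 0 then 1 else 0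
  | z :: l => MM g u v u' v' z.1 z.2 (TT g u v u' v' l)

/-! Kernel of the intertwiner -/

def ww (g u v u' : ℂ) (a m : ℕ) : ℂ :=
  (∏ i ∈ Finset.range (a + m), Complex.sin (g * (i + 1))) /
    ((∏ i ∈ Finset.range a, Complex.sin (g * (i + 1))) *
      (∏ i ∈ Finset.range m, Complex.sin (g * (i + 1)))) *
    (∏ i ∈ Finset.range m, Complex.sin (u - u' - g * i)) *
    (∏ i ∈ Finset.range a, Complex.sin (u' - v - g * i)) /
    (∏ i ∈ Finset.range (a + m), Complex.sin (u - v - g * i))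

lemma ww_zero (g u v u' : ℂ) : ww g u v u' 0 0 = 1 := by simp [ww]

section gen
variable {g u v u' : ℂ}

lemma R1 (hg : ∀ k : ℕ, Complex.sin (g * (k + 1)) ≠ 0)
    (hu : ∀ k : ℕ, Complex.sin (u - v - g * k) ≠ 0)
    (a m : ℕ) : ww g u v u' a (m + 1) * Complex.sin (g * (m + 1)) *
    Complex.sin (u - v - g * (a + m)) =
    ww g u v u' a m * Complex.sin (u - u' - g * m) * Complex.sin (g * (a + m + 1)) := by
  have h1 := hg m
  have h2 := hu (a + m)
  have h3 : ∀ n, (∏ i ∈ Finset.range n, Complex.sin (g * (i + 1))) ≠ 0 :=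
    fun n => Finset.prod_ne_zero_iff.2 fun i _ => hg i
  have h4 : ∀ n, (∏ i ∈ Finset.range n, Complex.sin (u - v - g * i)) ≠ 0 :=
    fun n => Finset.prod_ne_zero_iff.2 fun i _ => hu i
  have h5 := h3 a
  have h6 := h3 m
  have h7 := h4 (a + m)
  unfold ww
  rw [← add_assoc, Finset.prod_range_succ _ (a + m), Finset.prod_range_succ _ m,
    Finset.prod_range_succ _ m, Finset.prod_range_succ _ (a + m)]
  push_cast at *
  generalize (∏ i ∈ Finset.range (a + m), Complex.sin (g * (i + 1))) = p1 at *
  generalize (∏ i ∈ Finset.range (a + m), Complex.sin (u - v - g * i)) = p2 at *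
  generalize (∏ i ∈ Finset.range a, Complex.sin (g * (i + 1))) = p3 at *
  generalize (∏ i ∈ Finset.range m, Complex.sin (g * (i + 1))) = p4 at *
  generalize Complex.sin (g * (m + 1)) = q1 at *
  generalize Complex.sin (u - v - g * (a + m)) = q2 at *
  field_simp

lemma R2 (hg : ∀ k : ℕ, Complex.sin (g * (k + 1)) ≠ 0)
    (hu : ∀ k : ℕ, Complex.sin (u - v - g * k) ≠ 0)
    (a m : ℕ) : ww g u v u' (a + 1) m * Complex.sin (g * (a + 1)) *
    Complex.sin (u - v - g * (a + m)) =
    ww g u v u' a m * Complex.sin (u' - v - g * a) * Complex.sin (g * (a + m + 1)) := by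
  have h1 := hg a
  have h2 := hu (a + m)
  have h3 : ∀ n, (∏ i ∈ Finset.range n, Complex.sin (g * (i + 1))) ≠ 0 :=
    fun n => Finset.prod_ne_zero_iff.2 fun i _ => hg i
  have h4 : ∀ n, (∏ i ∈ Finset.range n, Complex.sin (u - v - g * i)) ≠ 0 :=
    fun n => Finset.prod_ne_zero_iff.2 fun i _ => hu i
  have h5 := h3 a
  have h6 := h3 m
  have h7 := h4 (a + m)
  unfold ww
  rw [Nat.add_right_comm, Finset.prod_range_succ _ (a + m), Finset.prod_range_succ _ a,
    Finset.prod_range_succ _ a, Finset.prod_range_succ _ (a + m)]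
  push_cast at *
  generalize (∏ i ∈ Finset.range (a + m), Complex.sin (g * (i + 1))) = p1 at *
  generalize (∏ i ∈ Finset.range (a + m), Complex.sin (u - v - g * i)) = p2 at *
  generalize (∏ i ∈ Finset.range a, Complex.sin (g * (i + 1))) = p3 at *
  generalize (∏ i ∈ Finset.range m, Complex.sin (g * (i + 1))) = p4 at *
  generalize Complex.sin (g * (a + 1)) = q1 at *
  generalize Complex.sin (u - v - g * (a + m)) = q2 at *
  field_simp

lemma R3 (hg : ∀ k : ℕ, Complex.sin (g * (k + 1)) ≠ 0)
    (hu : ∀ k : ℕ, Complex.sin (u - v - g * k) ≠ 0)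
    (a m : ℕ) : ww g u v u' a (m + 1) * Complex.sin (g * (m + 1)) *
    Complex.sin (u' - v - g * a) =
    ww g u v u' (a + 1) m * Complex.sin (g * (a + 1)) * Complex.sin (u - u' - g * m) := by
  have h2 := hu (a + m)
  push_cast at h2
  apply mul_right_cancel₀ h2
  linear_combination Complex.sin (u' - v - g * a) * R1 (u' := u') hg hu a m
    - Complex.sin (u - u' - g * m) * R2 (u' := u') hg hu a m

lemma R2z (hg : ∀ k : ℕ, Complex.sin (g * (k + 1)) ≠ 0)
    (hu : ∀ k : ℕ, Complex.sin (u - v - g * k) ≠ 0)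
    (a : ℕ) : ww g u v u' (a + 1) 0 * Complex.sin (u - v - g * a) =
    ww g u v u' a 0 * Complex.sin (u' - v - g * a) := by
  apply mul_right_cancel₀ (hg a)
  have := R2 (u' := u') hg hu a 0
  simp only [Nat.cast_zero, add_zero] at this
  linear_combination this

lemma R1z (hg : ∀ k : ℕ, Complex.sin (g * (k + 1)) ≠ 0)
    (hu : ∀ k : ℕ, Complex.sin (u - v - g * k) ≠ 0)
    (m : ℕ) : ww g u v u' 0 (m + 1) * Complex.sin (u - v - g * m) =
    ww g u v u' 0 m * Complex.sin (u - u' - g * m) := by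
  apply mul_right_cancel₀ (hg m)
  have := R1 (u' := u') hg hu 0 m
  simp only [Nat.cast_zero, zero_add] at this
  linear_combination this

end gen

def XX (g u v u' : ℂ) (ψ : ℕ → ℕ → ℂ) (a b : ℕ) : ℂ :=
  ∑ z ∈ Finset.HasAntidiagonal.antidiagonal b, ww g u v u' a z.1 * ψ (a + z.1) z.2

lemma sin_exp (x : ℂ) : Complex.sin x =
   ((Complex.exp (x * Complex.I))⁻¹ - Complex.exp (x * Complex.I)) * Complex.I / 2 := by
  rw [Complex.sin, ← Complex.exp_neg, neg_mul]

/-! trigonometric identities; `A,I,J` stand for `g*a` etc. -/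

lemma trig10 (g u v u' A I J : ℂ) :
    Complex.sin (I + g) * Complex.sin (u - v - (A + I)) * Complex.sin (u' - J)
    + Complex.sin (u - u' - I) * Complex.sin (v + (A + I + g)) * Complex.sin J
    = Complex.sin (I + g) * Complex.sin (u - (I + J)) * Complex.sin (u' - v - A)
    + Complex.sin (v + A) * Complex.sin (I + J + g) * Complex.sin (u - u' - I) := by
  simp only [sin_exp, add_mul, sub_mul, Complex.exp_add, Complex.exp_sub]
  have h := fun x => Complex.exp_ne_zero (x * Complex.I)
  have := h g; have := h u; have := h v; have := h u'; have := h A; have := h I; have := h J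
  generalize Complex.exp (g * Complex.I) = eg at *
  generalize Complex.exp (u * Complex.I) = eu at *
  generalize Complex.exp (v * Complex.I) = ev at *
  generalize Complex.exp (u' * Complex.I) = eu' at *
  generalize Complex.exp (A * Complex.I) = eA at *
  generalize Complex.exp (I * Complex.I) = eI at *
  generalize Complex.exp (J * Complex.I) = eJ at *
  field_simp
  ring

/- here `A = g*(a+1)` -/
lemma trig00 (g u u' A I J : ℂ) :
    Complex.sin (I + g) * Complex.sin (u - (A + I)) * Complex.sin (u' - J)
    + Complex.sin (u - u' - I) * Complex.sin (A + I + g) * Complex.sin J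
    = Complex.sin (I + g) * Complex.sin (u' - A) * Complex.sin (u - (I + J))
    + Complex.sin A * Complex.sin (u - u' - I) * Complex.sin (I + J + g) := by
  simp only [sin_exp, add_mul, sub_mul, Complex.exp_add, Complex.exp_sub]
  have h := fun x => Complex.exp_ne_zero (x * Complex.I)
  have := h g; have := h u; have := h u'; have := h A; have := h I; have := h J
  generalize Complex.exp (g * Complex.I) = eg at *
  generalize Complex.exp (u * Complex.I) = eu at *
  generalize Complex.exp (u' * Complex.I) = eu' at *
  generalize Complex.exp (A * Complex.I) = eA at *
  generalize Complex.exp (I * Complex.I) = eI at *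
  generalize Complex.exp (J * Complex.I) = eJ at *
  field_simp
  ring

lemma trig00z (u u' I J : ℂ) :
    Complex.sin (u - I) * Complex.sin (u' - J) + Complex.sin (u - u' - I) * Complex.sin J
    = Complex.sin u' * Complex.sin (u - (I + J)) := by
  simp only [sin_exp, add_mul, sub_mul, Complex.exp_add, Complex.exp_sub]
  have h := fun x => Complex.exp_ne_zero (x * Complex.I)
  have := h u; have := h u'; have := h I; have := h J
  generalize Complex.exp (u * Complex.I) = eu at *
  generalize Complex.exp (u' * Complex.I) = eu' at *
  generalize Complex.exp (I * Complex.I) = eI at *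
  generalize Complex.exp (J * Complex.I) = eJ at *
  field_simp
  ring

lemma trig01 (g u u' v' A I J : ℂ) :
    Complex.sin (I + g) * Complex.sin (u - (A + I)) * Complex.sin (u' - v' - J)
    + Complex.sin (u - u' - I) * Complex.sin (A + I + g) * Complex.sin (v' + J)
    = Complex.sin (I + g) * Complex.sin (u' - A) * Complex.sin (u - v' - (I + J))
    + Complex.sin A * Complex.sin (u - u' - I) * Complex.sin (v' + (I + J + g)) := by
  have := trig00 g u u' A I (v' + J)
  convert this using 4 <;> ring_nf

lemma trig01z (u u' v' I J : ℂ) :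
    Complex.sin (u - I) * Complex.sin (u' - v' - J)
      + Complex.sin (u - u' - I) * Complex.sin (v' + J)
    = Complex.sin u' * Complex.sin (u - v' - (I + J)) := by
  have := trig00z u u' I (v' + J)
  convert this using 3 <;> ring_nf

lemma trig11 (g u v u' v' A I J : ℂ) :
    Complex.sin (I + g) * Complex.sin (u - v - (A + I)) * Complex.sin (u' - v' - J)
    + Complex.sin (u - u' - I) * Complex.sin (v + (A + I + g)) * Complex.sin (v' + J)
    = Complex.sin (I + g) * Complex.sin (u - v' - (I + J)) * Complex.sin (u' - v - A)
    + Complex.sin (v + A) * Complex.sin (v' + (I + J + g)) * Complex.sin (u - u' - I) := by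
  have := trig10 g u v u' A I (v' + J)
  convert this using 4 <;> ring_nf

lemma trig10' (g u v u' a i j : ℂ) :
    Complex.sin (g * (i + 1)) * Complex.sin (u - v - g * (a + i)) * Complex.sin (u' - g * j)
    + Complex.sin (u - u' - g * i) * Complex.sin (v + g * (a + i + 1)) * Complex.sin (g * j)
    = Complex.sin (g * (i + 1)) * Complex.sin (u - g * (i + j)) * Complex.sin (u' - v - g * a)
    + Complex.sin (v + g * a) * Complex.sin (g * (i + j + 1)) * Complex.sin (u - u' - g * i) := by
  have := trig10 g u v u' (g * a) (g * i) (g * j)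
  convert this using 4 <;> ring_nf

lemma trig11' (g u v u' v' a i j : ℂ) :
    Complex.sin (g * (i + 1)) * Complex.sin (u - v - g * (a + i)) * Complex.sin (u' - v' - g * j)
    + Complex.sin (u - u' - g * i) * Complex.sin (v + g * (a + i + 1)) * Complex.sin (v' + g * j)
    = Complex.sin (g * (i + 1)) * Complex.sin (u - v' - g * (i + j)) * Complex.sin (u' - v - g * a)
    + Complex.sin (v + g * a) * Complex.sin (v' + g * (i + j + 1)) * Complex.sin (u - u' - g * i)
    := by
  have := trig11 g u v u' v' (g * a) (g * i) (g * j)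
  convert this using 4 <;> ring_nf

lemma trig00' (g u u' a i j : ℂ) :
    Complex.sin (g * (i + 1)) * Complex.sin (u - g * (a + 1 + i)) * Complex.sin (u' - g * j)
    + Complex.sin (u - u' - g * i) * Complex.sin (g * (a + 1 + i + 1)) * Complex.sin (g * j)
    = Complex.sin (g * (i + 1)) * Complex.sin (u' - g * (a + 1)) * Complex.sin (u - g * (i + j))
    + Complex.sin (g * (a + 1)) * Complex.sin (u - u' - g * i) * Complex.sin (g * (i + j + 1)) := by
  have := trig00 g u u' (g * (a + 1)) (g * i) (g * j)
  convert this using 4 <;> ring_nf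

lemma trig01' (g u u' v' a i j : ℂ) :
    Complex.sin (g * (i + 1)) * Complex.sin (u - g * (a + 1 + i)) * Complex.sin (u' - v' - g * j)
    + Complex.sin (u - u' - g * i) * Complex.sin (g * (a + 1 + i + 1)) * Complex.sin (v' + g * j)
    = Complex.sin (g * (i + 1)) * Complex.sin (u' - g * (a + 1)) * Complex.sin (u - v' - g * (i + j))
    + Complex.sin (g * (a + 1)) * Complex.sin (u - u' - g * i) * Complex.sin (v' + g * (i + j + 1))
    := by
  have := trig01 g u u' v' (g * (a + 1)) (g * i) (g * j)
  convert this using 4 <;> ring_nf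

lemma anti_shift (f : ℕ → ℕ → ℂ) (b : ℕ) (h0 : f (b + 1) 0 = 0) :
    ∑ z ∈ Finset.HasAntidiagonal.antidiagonal b, f z.1 (z.2 + 1)
      = f 0 (b + 1) + ∑ z ∈ Finset.HasAntidiagonal.antidiagonal b, f (z.1 + 1) z.2 := by
  have h1 := Finset.Nat.sum_antidiagonal_succ (n := b) (f := fun z => f z.1 z.2)
  have h2 := Finset.Nat.sum_antidiagonal_succ' (n := b) (f := fun z => f z.1 z.2)
  simp only [h0, zero_add] at h2
  rw [← h2, h1]

section inter
variable {g u v u' : ℂ} (v' : ℂ)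


lemma rse_zero (c f : ℕ → ℂ) : rse c f 0 = 0 := rfl
lemma rse_succ (c f : ℕ → ℂ) (k : ℕ) : rse c f (k + 1) = c k * f k := rfl

lemma MM00 (g u v u' v' : ℂ) (ψ : ℕ → ℕ → ℂ) (a b : ℕ) : MM g u v u' v' 0 0 ψ a b =
    Complex.sin (u - g * a) * (Complex.sin (u' - g * b) * ψ a b)
    + rse (fun k => Complex.sin (u - v - g * k))
      (fun p => Complex.sin (g * (b + 1)) * ψ p (b + 1)) a := by
  simp [MM, lax, Fin.sum_univ_two]

lemma MM01 (g u v u' v' : ℂ) (ψ : ℕ → ℕ → ℂ) (a b : ℕ) : MM g u v u' v' 0 1 ψ a b =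
    Complex.sin (u - g * a) * rse (fun k => Complex.sin (u' - v' - g * k)) (ψ a) b
    + rse (fun k => Complex.sin (u - v - g * k))
      (fun p => Complex.sin (v' + g * b) * ψ p b) a := by
  simp [MM, lax, Fin.sum_univ_two]

lemma MM10 (g u v u' v' : ℂ) (ψ : ℕ → ℕ → ℂ) (a b : ℕ) : MM g u v u' v' 1 0 ψ a b =
    Complex.sin (g * (a + 1)) * (Complex.sin (u' - g * b) * ψ (a + 1) b)
    + Complex.sin (v + g * a) * (Complex.sin (g * (b + 1)) * ψ a (b + 1)) := by
  simp [MM, lax, Fin.sum_univ_two]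

lemma MM11 (g u v u' v' : ℂ) (ψ : ℕ → ℕ → ℂ) (a b : ℕ) : MM g u v u' v' 1 1 ψ a b =
    Complex.sin (g * (a + 1)) * rse (fun k => Complex.sin (u' - v' - g * k)) (ψ (a + 1)) b
    + Complex.sin (v + g * a) * (Complex.sin (v' + g * b) * ψ a b) := by
  simp [MM, lax, Fin.sum_univ_two]

lemma inter10 (hg : ∀ k : ℕ, Complex.sin (g * (k + 1)) ≠ 0)
    (hu : ∀ k : ℕ, Complex.sin (u - v - g * k) ≠ 0) (ψ : ℕ → ℕ → ℂ) (a b : ℕ) :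
    XX g u v u' (MM g u v u' v' 1 0 ψ) a b = MM g u' v u v' 1 0 (XX g u v u' ψ) a b := by
  simp only [XX, MM10]
  simp only [mul_add (ww _ _ _ _ _ _), Finset.sum_add_distrib]
  rw [Finset.Nat.sum_antidiagonal_succ]
  have e := anti_shift (fun i j => ww g u v u' a i * (Complex.sin (v + g * ((a + i : ℕ) : ℂ)) *
    (Complex.sin (g * j) * ψ (a + i) j))) b (by simp)
  have key : ∑ z ∈ Finset.HasAntidiagonal.antidiagonal b, ww g u v u' a z.1 *
        (Complex.sin (g * (((a + z.1 : ℕ) : ℂ) + 1)) *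
          (Complex.sin (u' - g * z.2) * ψ (a + z.1 + 1) z.2))
      + ∑ z ∈ Finset.HasAntidiagonal.antidiagonal b, ww g u v u' a (z.1 + 1) *
        (Complex.sin (v + g * ((a + (z.1 + 1) : ℕ) : ℂ)) *
          (Complex.sin (g * z.2) * ψ (a + (z.1 + 1)) z.2))
      = Complex.sin (g * (a + 1)) * (Complex.sin (u - g * b) *
        ∑ z ∈ Finset.HasAntidiagonal.antidiagonal b, ww g u v u' (a + 1) z.1 * ψ (a + 1 + z.1) z.2)
      + Complex.sin (v + g * a) * (Complex.sin (g * (b + 1)) *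
        ∑ z ∈ Finset.HasAntidiagonal.antidiagonal b, ww g u v u' a (z.1 + 1) * ψ (a + (z.1 + 1)) z.2) := by
    simp only [Finset.mul_sum, ← Finset.sum_add_distrib]
    refine Finset.sum_congr rfl ?_
    rintro ⟨i, j⟩ h
    rw [Finset.HasAntidiagonal.mem_antidiagonal] at h
    subst h
    rw [Nat.add_right_comm a 1 i, ← add_assoc a i 1]
    have h1 := R1 (u' := u') hg hu a i
    have h2 := R2 (u' := u') hg hu a i
    have t := trig10' g u v u' a i j
    have n1 := hg i
    have n2 := hu (a + i)
    push_cast at *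
    apply mul_left_cancel₀ (mul_ne_zero n1 n2)
    linear_combination ψ (a + i + 1) j * ((Complex.sin (v + g * (a + i + 1)) * Complex.sin (g * j)
      - Complex.sin (v + g * a) * Complex.sin (g * (i + j + 1))) * h1
      - Complex.sin (g * (i + 1)) * Complex.sin (u - g * (i + j)) * h2
      + ww g u v u' a i * Complex.sin (g * (a + i + 1)) * t)
  push_cast at *
  simp only [add_zero] at *
  linear_combination e + key

lemma inter11 (hg : ∀ k : ℕ, Complex.sin (g * (k + 1)) ≠ 0)
    (hu : ∀ k : ℕ, Complex.sin (u - v - g * k) ≠ 0) (ψ : ℕ → ℕ → ℂ) (a b : ℕ) :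
    XX g u v u' (MM g u v u' v' 1 1 ψ) a b = MM g u' v u v' 1 1 (XX g u v u' ψ) a b := by
  cases b with
  | zero => simp [XX, MM11, rse]; ring
  | succ b =>
  simp only [XX, MM11]
  simp only [mul_add (ww _ _ _ _ _ _), Finset.sum_add_distrib]
  rw [Finset.Nat.sum_antidiagonal_succ']
  simp only [rse_succ, rse_zero, mul_zero, zero_add, XX]
  rw [Finset.Nat.sum_antidiagonal_succ, Finset.Nat.sum_antidiagonal_succ]
  have key : ∑ z ∈ Finset.HasAntidiagonal.antidiagonal b, ww g u v u' a z.1 *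
        (Complex.sin (g * (((a + z.1 : ℕ) : ℂ) + 1)) *
          (Complex.sin (u' - v' - g * z.2) * ψ (a + z.1 + 1) z.2))
      + ∑ z ∈ Finset.HasAntidiagonal.antidiagonal b, ww g u v u' a (z.1 + 1) *
        (Complex.sin (v + g * ((a + (z.1 + 1) : ℕ) : ℂ)) *
          (Complex.sin (v' + g * z.2) * ψ (a + (z.1 + 1)) z.2))
      = Complex.sin (g * (a + 1)) * (Complex.sin (u - v' - g * b) *
        ∑ z ∈ Finset.HasAntidiagonal.antidiagonal b, ww g u v u' (a + 1) z.1 * ψ (a + 1 + z.1) z.2)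
      + Complex.sin (v + g * a) * (Complex.sin (v' + g * (b + 1)) *
        ∑ z ∈ Finset.HasAntidiagonal.antidiagonal b, ww g u v u' a (z.1 + 1) * ψ (a + (z.1 + 1)) z.2) := by
    simp only [Finset.mul_sum, ← Finset.sum_add_distrib]
    refine Finset.sum_congr rfl ?_
    rintro ⟨i, j⟩ h
    rw [Finset.HasAntidiagonal.mem_antidiagonal] at h
    subst h
    rw [Nat.add_right_comm a 1 i, ← add_assoc a i 1]
    have h1 := R1 (u' := u') hg hu a i
    have h2 := R2 (u' := u') hg hu a i
    have t := trig11' g u v u' v' a i j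
    have n1 := hg i
    have n2 := hu (a + i)
    push_cast at *
    apply mul_left_cancel₀ (mul_ne_zero n1 n2)
    linear_combination ψ (a + i + 1) j * ((Complex.sin (v + g * (a + i + 1)) *
      Complex.sin (v' + g * j)
      - Complex.sin (v + g * a) * Complex.sin (v' + g * (i + j + 1))) * h1
      - Complex.sin (g * (i + 1)) * Complex.sin (u - v' - g * (i + j)) * h2
      + ww g u v u' a i * Complex.sin (g * (a + i + 1)) * t)
  push_cast at *
  simp only [add_zero] at *
  linear_combination key

lemma inter00 (hg : ∀ k : ℕ, Complex.sin (g * (k + 1)) ≠ 0)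
    (hu : ∀ k : ℕ, Complex.sin (u - v - g * k) ≠ 0) (ψ : ℕ → ℕ → ℂ) (a b : ℕ) :
    XX g u v u' (MM g u v u' v' 0 0 ψ) a b = MM g u' v u v' 0 0 (XX g u v u' ψ) a b := by
  simp only [XX, MM00]
  simp only [mul_add (ww _ _ _ _ _ _), Finset.sum_add_distrib]
  cases a with
  | zero =>
    have e : ∑ z ∈ Finset.HasAntidiagonal.antidiagonal b, ww g u v u' 0 z.1 *
        rse (fun k => Complex.sin (u - v - g * k))
          (fun p => Complex.sin (g * (z.2 + 1)) * ψ p (z.2 + 1)) (0 + z.1)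
        = ∑ z ∈ Finset.HasAntidiagonal.antidiagonal b, ww g u v u' 0 (z.1 + 1) *
          (Complex.sin (u - v - g * z.1) * (Complex.sin (g * z.2) * ψ z.1 z.2)) := by
      have := anti_shift (fun i j => ww g u v u' 0 i *
        rse (fun k => Complex.sin (u - v - g * k))
          (fun p => Complex.sin (g * j) * ψ p j) (0 + i)) b (by simp [rse])
      simpa [rse] using this
    rw [e]
    simp only [rse, add_zero, Finset.mul_sum, ← Finset.sum_add_distrib]
    refine Finset.sum_congr rfl ?_
    rintro ⟨i, j⟩ h
    rw [Finset.HasAntidiagonal.mem_antidiagonal] at h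
    subst h
    have h1 := R1z (u' := u') hg hu i
    have t := trig00z u u' (g * i) (g * j)
    simp only [zero_add, Nat.cast_zero, mul_zero, sub_zero, Nat.cast_add, mul_add g] at *
    linear_combination ψ i j * (Complex.sin (g * j) * h1 + ww g u v u' 0 i * t)
  | succ a =>
    have e := anti_shift (fun i j => ww g u v u' (a + 1) i *
        rse (fun k => Complex.sin (u - v - g * k))
          (fun p => Complex.sin (g * j) * ψ p j) (a + 1 + i)) b
            (by simp [rse, Nat.add_right_comm a 1])
    have key : ∑ z ∈ Finset.HasAntidiagonal.antidiagonal b, ww g u v u' (a + 1) z.1 *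
        (Complex.sin (u - g * ((a + 1 + z.1 : ℕ) : ℂ)) *
          (Complex.sin (u' - g * z.2) * ψ (a + 1 + z.1) z.2))
      + ∑ z ∈ Finset.HasAntidiagonal.antidiagonal b, ww g u v u' (a + 1) (z.1 + 1) *
        (Complex.sin (u - v - g * ((a + (z.1 + 1) : ℕ) : ℂ)) *
          (Complex.sin (g * z.2) * ψ (a + (z.1 + 1)) z.2))
      = Complex.sin (u' - g * ((a + 1 : ℕ) : ℂ)) * (Complex.sin (u - g * b) *
        ∑ z ∈ Finset.HasAntidiagonal.antidiagonal b, ww g u v u' (a + 1) z.1 * ψ (a + 1 + z.1) z.2)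
      + Complex.sin (u' - v - g * a) * (Complex.sin (g * (b + 1)) *
        ∑ z ∈ Finset.HasAntidiagonal.antidiagonal b, ww g u v u' a (z.1 + 1) * ψ (a + (z.1 + 1)) z.2) := by
      simp only [Finset.mul_sum, ← Finset.sum_add_distrib]
      refine Finset.sum_congr rfl ?_
      rintro ⟨i, j⟩ h
      rw [Finset.HasAntidiagonal.mem_antidiagonal] at h
      subst h
      rw [← add_assoc a i 1, Nat.add_right_comm a i 1]
      have h1 := R1 (u' := u') hg hu (a + 1) i
      have h3 := R3 (u' := u') hg hu a i
      have t := trig00' g u u' a i j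
      have n1 := hg i
      push_cast at *
      apply mul_left_cancel₀ n1
      linear_combination ψ (a + 1 + i) j * (Complex.sin (g * j) * h1
        - Complex.sin (g * (i + j + 1)) * h3 + ww g u v u' (a + 1) i * t)
    have z := R2z (u' := u') hg hu a
    simp only [rse_succ]
    rw [Finset.Nat.sum_antidiagonal_succ]
    simp only [← add_assoc, add_zero, zero_add, rse_succ] at *
    simp only [Nat.add_right_comm a 1, rse_succ] at *
    push_cast at *
    linear_combination e + key + Complex.sin (g * (b + 1)) * ψ a (b + 1) * z

lemma inter01 (hg : ∀ k : ℕ, Complex.sin (g * (k + 1)) ≠ 0)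
    (hu : ∀ k : ℕ, Complex.sin (u - v - g * k) ≠ 0) (ψ : ℕ → ℕ → ℂ) (a b : ℕ) :
    XX g u v u' (MM g u v u' v' 0 1 ψ) a b = MM g u' v u v' 0 1 (XX g u v u' ψ) a b := by
  simp only [XX, MM01]
  cases b with
  | zero =>
    cases a with
    | zero => simp [rse]
    | succ a =>
      have z := R2z (u' := u') hg hu a
      simp [rse]
      linear_combination Complex.sin v' * ψ a 0 * z
  | succ b =>
  simp only [mul_add (ww _ _ _ _ _ _), Finset.sum_add_distrib]
  rw [Finset.Nat.sum_antidiagonal_succ']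
  cases a with
  | zero =>
    rw [Finset.Nat.sum_antidiagonal_succ]
    simp only [rse_succ, rse_zero, XX, add_zero, zero_add, mul_zero, Finset.mul_sum, ← Finset.sum_add_distrib]
    refine Finset.sum_congr rfl ?_
    rintro ⟨i, j⟩ h
    rw [Finset.HasAntidiagonal.mem_antidiagonal] at h
    subst h
    have h1 := R1z (u' := u') hg hu i
    have t := trig01z u u' v' (g * i) (g * j)
    simp only [Nat.cast_zero, mul_zero, sub_zero, Nat.cast_add, mul_add g] at *
    linear_combination ψ i j * (Complex.sin (v' + g * j) * h1 + ww g u v u' 0 i * t)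
  | succ a =>
    have key : ∑ z ∈ Finset.HasAntidiagonal.antidiagonal b, ww g u v u' (a + 1) z.1 *
        (Complex.sin (u - g * ((a + 1 + z.1 : ℕ) : ℂ)) *
          (Complex.sin (u' - v' - g * z.2) * ψ (a + 1 + z.1) z.2))
      + ∑ z ∈ Finset.HasAntidiagonal.antidiagonal b, ww g u v u' (a + 1) (z.1 + 1) *
        (Complex.sin (u - v - g * ((a + (z.1 + 1) : ℕ) : ℂ)) *
          (Complex.sin (v' + g * z.2) * ψ (a + (z.1 + 1)) z.2))
      = Complex.sin (u' - g * ((a + 1 : ℕ) : ℂ)) * (Complex.sin (u - v' - g * b) *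
        ∑ z ∈ Finset.HasAntidiagonal.antidiagonal b, ww g u v u' (a + 1) z.1 * ψ (a + 1 + z.1) z.2)
      + Complex.sin (u' - v - g * a) * (Complex.sin (v' + g * (b + 1)) *
        ∑ z ∈ Finset.HasAntidiagonal.antidiagonal b, ww g u v u' a (z.1 + 1) * ψ (a + (z.1 + 1)) z.2) := by
      simp only [Finset.mul_sum, ← Finset.sum_add_distrib]
      refine Finset.sum_congr rfl ?_
      rintro ⟨i, j⟩ h
      rw [Finset.HasAntidiagonal.mem_antidiagonal] at h
      subst h
      rw [← add_assoc a i 1, Nat.add_right_comm a i 1]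
      have h1 := R1 (u' := u') hg hu (a + 1) i
      have h3 := R3 (u' := u') hg hu a i
      have t := trig01' g u u' v' a i j
      have n1 := hg i
      push_cast at *
      apply mul_left_cancel₀ n1
      linear_combination ψ (a + 1 + i) j * (Complex.sin (v' + g * j) * h1
        - Complex.sin (v' + g * (i + j + 1)) * h3 + ww g u v u' (a + 1) i * t)
    have z := R2z (u' := u') hg hu a
    rw [Finset.Nat.sum_antidiagonal_succ]
    simp only [rse_succ, rse_zero, XX]
    rw [Finset.Nat.sum_antidiagonal_succ]
    simp only [← add_assoc, add_zero, zero_add, mul_zero, rse_succ] at *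
    simp only [Nat.add_right_comm a 1, rse_succ] at *
    push_cast at *
    linear_combination key + Complex.sin (v' + g * (b + 1)) * ψ a (b + 1) * z

end inter

lemma inter_all {g u v u' : ℂ} (v' : ℂ) (hg : ∀ k : ℕ, Complex.sin (g * (k + 1)) ≠ 0)
    (hu : ∀ k : ℕ, Complex.sin (u - v - g * k) ≠ 0) (x y : Fin 2) (ψ : ℕ → ℕ → ℂ) :
    XX g u v u' (MM g u v u' v' x y ψ) = MM g u' v u v' x y (XX g u v u' ψ) := by
  funext a b
  fin_cases x <;> fin_cases y
  · exact inter00 v' hg hu ψ a b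
  · exact inter01 v' hg hu ψ a b
  · exact inter10 v' hg hu ψ a b
  · exact inter11 v' hg hu ψ a b

lemma XX_TT {g u v u' : ℂ} (v' : ℂ) (hg : ∀ k : ℕ, Complex.sin (g * (k + 1)) ≠ 0)
    (hu : ∀ k : ℕ, Complex.sin (u - v - g * k) ≠ 0) (l : List (Fin 2 × Fin 2)) :
    XX g u v u' (TT g u v u' v' l) = TT g u' v u v' l := by
  induction l with
  | nil =>
    funext a b
    simp only [XX, TT]
    cases b with
    | zero =>
      rw [show Finset.HasAntidiagonal.antidiagonal 0 = {((0 : ℕ), (0 : ℕ))} from rfl,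
        Finset.sum_singleton]
      by_cases h : a = 0
      · subst h; simp [ww_zero]
      · simp [h]
    | succ b =>
      rw [if_neg (by simp)]
      apply Finset.sum_eq_zero
      rintro ⟨i, j⟩ h
      rw [Finset.HasAntidiagonal.mem_antidiagonal] at h
      rw [if_neg, mul_zero]
      rintro ⟨h1, h2⟩
      simp only at h h1 h2
      omega
  | cons z l ih => simp only [TT]; rw [inter_all v' hg hu, ih]

lemma swapU_gen {g u v u' : ℂ} (v' : ℂ) (hg : ∀ k : ℕ, Complex.sin (g * (k + 1)) ≠ 0)
    (hu : ∀ k : ℕ, Complex.sin (u - v - g * k) ≠ 0) (l : List (Fin 2 × Fin 2)) :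
    TT g u v u' v' l 0 0 = TT g u' v u v' l 0 0 := by
  rw [← XX_TT v' hg hu]
  simp [XX, ww_zero]

lemma TT_cont {g u v u' v' : ℂ → ℂ} (hg : Continuous g) (hu : Continuous u) (hv : Continuous v)
    (hu' : Continuous u') (hv' : Continuous v') (l : List (Fin 2 × Fin 2)) :
    ∀ a b, Continuous fun x => TT (g x) (u x) (v x) (u' x) (v' x) l a b := by
  induction l with
  | nil => intro a b; exact continuous_const
  | cons z l ih =>
    obtain ⟨x, y⟩ := z
    have ih' : ∀ (a b : ℕ), Continuous fun x => TT (g x) (u x) (v x) (u' x) (v' x) l a b := ih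
    intro a b
    simp only [TT]
    fin_cases x <;> fin_cases y
    · simp only [Fin.zero_eta, MM00]
      cases a <;> simp only [rse_zero, rse_succ] <;> fun_prop
    · simp only [Fin.zero_eta, Fin.mk_one, MM01]
      cases a <;> cases b <;> simp only [rse_zero, rse_succ] <;> fun_prop
    · simp only [Fin.zero_eta, Fin.mk_one, MM10]
      fun_prop
    · simp only [Fin.mk_one, MM11]
      cases b <;> simp only [rse_zero, rse_succ] <;> fun_prop

lemma dense_sin (c d : ℕ → ℂ) (hc : ∀ k, c k ≠ 0) :
    Dense {x : ℂ | ∀ k, Complex.sin (x * c k + d k) ≠ 0} := by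
  have hco : (Set.range fun p : ℕ × ℤ => (p.2 * (Real.pi : ℂ) - d p.1) / c p.1).Countable :=
    Set.countable_range _
  refine (hco.dense_compl ℂ).mono ?_
  intro x hx k h
  apply hx
  rw [Complex.sin_eq_zero_iff] at h
  obtain ⟨z, hz⟩ := h
  refine ⟨(k, z), ?_⟩
  have := hc k
  simp only
  rw [← hz]
  field_simp
  ring

lemma swapU (g u v u' v' : ℂ) (l : List (Fin 2 × Fin 2)) :
    TT g u v u' v' l 0 0 = TT g u' v u v' l 0 0 := by
  have step1 : ∀ g : ℂ, (∀ k : ℕ, Complex.sin (g * (k + 1)) ≠ 0) →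
      TT g u v u' v' l 0 0 = TT g u' v u v' l 0 0 := by
    intro g hg
    have hd := dense_sin (fun _ => 1) (fun k => - v - g * k) (fun _ => one_ne_zero)
    have := Continuous.ext_on (f := fun x => TT g x v u' v' l 0 0)
      (g := fun x => TT g u' v x v' l 0 0) hd
      (TT_cont continuous_const continuous_id continuous_const continuous_const
        continuous_const l 0 0)
      (TT_cont continuous_const continuous_const continuous_const continuous_id
        continuous_const l 0 0)
      (by
        intro x hx
        refine swapU_gen v' hg ?_ l
        intro k
        have := hx k
        convert this using 2
        ring)
    exact congrFun this u
  have hd := dense_sin (fun k => (k : ℂ) + 1) (fun _ => 0) (fun k => Nat.cast_add_one_ne_zero k)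
  have := Continuous.ext_on (f := fun x => TT x u v u' v' l 0 0)
      (g := fun x => TT x u' v u v' l 0 0) hd
      (TT_cont continuous_id continuous_const continuous_const continuous_const
        continuous_const l 0 0)
      (TT_cont continuous_id continuous_const continuous_const continuous_const
        continuous_const l 0 0)
      (by
        intro x hx
        refine step1 x ?_
        intro k
        simpa using hx k)
  exact congrFun this g

def flp (z : Fin 2 × Fin 2) : Fin 2 × Fin 2 := (1 - z.2, 1 - z.1)

def sg (z : Fin 2 × Fin 2) : ℂ := if z.1 = z.2 then 1 else -1

lemma MM_flip (g u v u' v' : ℂ) (z : Fin 2 × Fin 2) (ψ : ℕ → ℕ → ℂ) (a b : ℕ) :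
    MM g u v u' v' z.1 z.2 ψ a b =
      sg z * MM (-g) v' u' v u (flp z).1 (flp z).2 (fun p q => ψ q p) b a := by
  obtain ⟨x, y⟩ := z
  have s1 : ∀ p : ℂ, Complex.sin (-g * p) = - Complex.sin (g * p) := fun p => by
    rw [neg_mul, Complex.sin_neg]
  have s2 : ∀ p q r : ℂ, Complex.sin (q - r - -g * p) = - Complex.sin (r - q - g * p) :=
    fun p q r => by rw [← Complex.sin_neg]; ring_nf
  have s3 : ∀ p r : ℂ, Complex.sin (r - -g * p) = Complex.sin (r + g * p) :=
    fun p r => by ring_nf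
  have s4 : ∀ p r : ℂ, Complex.sin (r + -g * p) = Complex.sin (r - g * p) :=
    fun p r => by ring_nf
  fin_cases x <;> fin_cases y
  · simp only [sg, flp, Fin.zero_eta, Fin.mk_one, sub_zero, if_true, MM00, MM11]
    cases a <;> simp only [rse_zero, rse_succ, s1, s2, s4] <;> ring
  · simp only [sg, flp, Fin.zero_eta, Fin.mk_one, sub_zero, sub_self, zero_ne_one, if_false, MM01]
    cases a <;> cases b <;> simp only [rse_zero, rse_succ, s2, s3, s4] <;> ring
  · simp only [sg, flp, Fin.zero_eta, Fin.mk_one, sub_zero, sub_self, one_ne_zero, if_false, MM10]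
    simp only [s1, s3, s4]; ring
  · simp only [sg, flp, Fin.mk_one, sub_self, if_true, MM00, MM11]
    cases b <;> simp only [rse_zero, rse_succ, s1, s2, s3] <;> ring

lemma MM_smul (g u v u' v' : ℂ) (x y : Fin 2) (c : ℂ) (ψ : ℕ → ℕ → ℂ) (a b : ℕ) :
    MM g u v u' v' x y (fun p q => c * ψ p q) a b = c * MM g u v u' v' x y ψ a b := by
  fin_cases x <;> fin_cases y
  · simp only [Fin.zero_eta, MM00]
    cases a <;> simp only [rse_zero, rse_succ] <;> ring
  · simp only [Fin.zero_eta, Fin.mk_one, MM01]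
    cases a <;> cases b <;> simp only [rse_zero, rse_succ] <;> ring
  · simp only [Fin.zero_eta, Fin.mk_one, MM10]
    ring
  · simp only [Fin.mk_one, MM11]
    cases b <;> simp only [rse_zero, rse_succ] <;> ring

lemma TT_flip (g u v u' v' : ℂ) (l : List (Fin 2 × Fin 2)) :
    ∀ a b, TT g u v u' v' l a b =
      (l.map sg).prod * TT (-g) v' u' v u (l.map flp) b a := by
  induction l with
  | nil => intro a b; simp [TT, and_comm]
  | cons z l ih =>
    intro a b
    have ih' : TT g u v u' v' l =
      fun a b => (l.map sg).prod * TT (-g) v' u' v u (l.map flp) b a := by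
      funext a b; exact ih a b
    simp only [TT, List.map_cons, List.prod_cons]
    rw [ih', MM_smul, MM_flip]
    ring

lemma swapV (g u v u' v' : ℂ) (l : List (Fin 2 × Fin 2)) :
    TT g u v u' v' l 0 0 = TT g u v' u' v l 0 0 := by
  rw [TT_flip, TT_flip g u v', swapU]

lemma lax_sum {ι : Type} (t : Finset ι) (g u v : ℂ) (x y : Fin 2) (c : ι → ℂ) (f : ι → ℕ → ℂ)
    (k : ℕ) : lax g u v x y (fun p => ∑ i ∈ t, c i * f i p) k
      = ∑ i ∈ t, c i * lax g u v x y (f i) k := by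
  fin_cases x <;> fin_cases y <;> simp [lax]
  · rw [Finset.mul_sum]; exact Finset.sum_congr rfl fun _ _ => by ring
  · cases k
    · simp [rse]
    · simp only [rse]; rw [Finset.mul_sum]; exact Finset.sum_congr rfl fun _ _ => by ring
  · rw [Finset.mul_sum]; exact Finset.sum_congr rfl fun _ _ => by ring
  · rw [Finset.mul_sum]; exact Finset.sum_congr rfl fun _ _ => by ring

lemma sin_qnum (γ : ℝ) (hγ : Real.sin γ ≠ 0) (x : ℂ) :
    (Real.sin γ : ℂ) * qnum γ x = Complex.sin (γ * x) := by
  have h : Complex.sin γ ≠ 0 := by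
    rw [← Complex.ofReal_sin]; exact_mod_cast hγ
  have e : ∀ y : ℂ, Complex.exp (Complex.I * y) - Complex.exp (-(Complex.I * y))
      = 2 * Complex.I * Complex.sin y := by
    intro y
    rw [Complex.sin]
    have : Complex.I * Complex.I = -1 := Complex.I_mul_I
    rw [show -(Complex.I * y) = -y * Complex.I by ring, show Complex.I * y = y * Complex.I by ring]
    linear_combination (-(Complex.exp (-y * Complex.I)) + Complex.exp (y * Complex.I)) * this
  have hI := Complex.I_ne_zero
  rw [qnum, mul_assoc, e, e, Complex.ofReal_sin]
  field_simp

lemma ofBasis_single (w : ℕ → Ha) (l : ℕ) (c : ℂ) :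
    ofBasis w (Finsupp.single l c) = c • w l := by
  simp [ofBasis]

lemma lax_add (g u v : ℂ) (x y : Fin 2) (f f' : ℕ → ℂ) (k : ℕ) :
    lax g u v x y (f + f') k = lax g u v x y f k + lax g u v x y f' k := by
  have := lax_sum (Finset.univ : Finset (Fin 2)) g u v x y (fun _ => 1) ![f, f'] k
  simp only [Fin.sum_univ_two, one_mul] at this
  exact this

lemma lax_zero (g u v : ℂ) (x y : Fin 2) (k : ℕ) : lax g u v x y 0 k = 0 := by
  have := lax_sum (∅ : Finset (Fin 2)) g u v x y (fun _ => 1) ![0, 0] k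
  simp only [Finset.sum_empty] at this
  exact this

lemma LaxM_apply (γ : ℝ) (hγ : Real.sin γ ≠ 0) (φ s : ℂ) (x y : Fin 2) (f : Ha) (k : ℕ) :
    LaxM γ φ s x y f k = lax γ (φ + γ * s) (φ - γ * s) x y f k := by
  induction f using Finsupp.induction_linear with
  | zero => rw [map_zero, Finsupp.coe_zero, lax_zero]; rfl
  | add f f' h h' => 
    have e : (⇑(f + f') : ℕ → ℂ) = ⇑f + ⇑f' := Finsupp.coe_add f f'
    rw [e, lax_add, ← h, ← h', map_add]; rfl
  | single l c =>
    have q := sin_qnum γ hγ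
    fin_cases x <;> fin_cases y
    · simp only [LaxM, lax, diagOp, Fin.zero_eta, Matrix.of_apply, Matrix.cons_val', Matrix.cons_val_zero,
        ofBasis_single, if_true, Finsupp.smul_apply, smul_eq_mul]
      by_cases h : l = k
      · subst h; simp; ring_nf
      · simp [h]
    · simp only [LaxM, lax, Sm, Fin.zero_eta, Fin.mk_one, Matrix.of_apply, Matrix.cons_val', Matrix.cons_val_zero,
        Matrix.cons_val_one, LinearMap.smul_apply,
        ofBasis_single, if_true, if_false, one_ne_zero, Finsupp.smul_apply, smul_eq_mul]
      cases k with
      | zero => simp [rse]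
      | succ k =>
        rw [rse_succ]
        by_cases h : l = k
        · subst h
          have := q (2 * s - l)
          simp only [Finsupp.single_eq_same]
          rw [show φ + γ * s - (φ - γ * s) - γ * l = γ * (2 * s - l) by ring, ← this]
          ring
        · simp [h]
    · simp only [LaxM, lax, Sp, Fin.zero_eta, Fin.mk_one, Matrix.of_apply, Matrix.cons_val', Matrix.cons_val_zero,
        Matrix.cons_val_one, LinearMap.smul_apply,
        ofBasis_single, if_true, if_false, one_ne_zero, Finsupp.smul_apply, smul_eq_mul]
      cases l with
      | zero => simp
      | succ l =>
        by_cases h : l = k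
        · subst h
          have := q (l + 1)
          simp only [Finsupp.single_eq_same, Finsupp.smul_apply, smul_eq_mul]
          rw [← this]
          ring
        · simp [h]
    · change diagOp (fun k => Complex.sin (φ - γ * (s - (k : ℂ)))) (Finsupp.single l c) k = lax _ _ _ 1 1 _ k
      simp only [lax, diagOp, Fin.mk_one, Matrix.of_apply, Matrix.cons_val', Matrix.cons_val_one,
        ofBasis_single, if_false, one_ne_zero, Finsupp.smul_apply, smul_eq_mul]
      by_cases h : l = k
      · subst h; simp; ring_nf
      · simp [h]

def vcol (γ : ℝ) (n : ℕ) (s φ : ℂ) (σ τ : Fin n → Fin 2) : Ha :=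
  (List.ofFn fun j : Fin n =>
      (LaxM γ φ s (σ j) (τ j) : Module.End ℂ Ha)).prod (Finsupp.single 0 1)

lemma vcol_succ (γ : ℝ) (hγ : Real.sin γ ≠ 0) (n : ℕ) (s φ : ℂ) (σ τ : Fin (n + 1) → Fin 2)
    (k : ℕ) :
    vcol γ (n + 1) s φ σ τ k = lax γ (φ + γ * s) (φ - γ * s) (σ 0) (τ 0)
      (vcol γ n s φ (fun i => σ i.succ) (fun i => τ i.succ)) k := by
  rw [← LaxM_apply γ hγ]
  rw [vcol, vcol, List.ofFn_succ, List.prod_cons]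
  rfl

lemma vcol_TT (γ : ℝ) (hγ : Real.sin γ ≠ 0) (s s' φ φ' : ℂ) (n : ℕ) :
    ∀ (σ τ : Fin n → Fin 2) (a b : ℕ),
    ∑ ρ : Fin n → Fin 2, vcol γ n s φ σ ρ a * vcol γ n s' φ' ρ τ b =
      TT γ (φ + γ * s) (φ - γ * s) (φ' + γ * s') (φ' - γ * s')
        (List.ofFn fun j => (σ j, τ j)) a b := by
  induction n with
  | zero =>
    intro σ τ a b
    simp [vcol, TT, Finsupp.single_apply, eq_comm, ← ite_and]
    simp only [and_comm]
  | succ n ih =>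
    intro σ τ a b
    rw [List.ofFn_succ]
    simp only [TT]
    have ih' := fun a b => (ih (fun i => σ i.succ) (fun i => τ i.succ) a b).symm
    rw [MM]
    rw [← (Fin.consEquiv (fun _ : Fin (n + 1) => Fin 2)).sum_comp, Fintype.sum_prod_type]
    refine Finset.sum_congr rfl fun r _ => ?_
    have e : (fun p => lax γ (φ' + γ * s') (φ' - γ * s') r (τ 0)
        (TT γ (φ + γ * s) (φ - γ * s) (φ' + γ * s') (φ' - γ * s')
          (List.ofFn fun i => (σ i.succ, τ i.succ)) p) b) =
        fun p => ∑ ρ : Fin n → Fin 2,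
          lax γ (φ' + γ * s') (φ' - γ * s') r (τ 0)
            (vcol γ n s' φ' ρ (fun i => τ i.succ)) b * vcol γ n s φ (fun i => σ i.succ) ρ p := by
      funext p
      have : TT γ (φ + γ * s) (φ - γ * s) (φ' + γ * s') (φ' - γ * s')
          (List.ofFn fun i => (σ i.succ, τ i.succ)) p = fun q => ∑ ρ : Fin n → Fin 2,
            vcol γ n s φ (fun i => σ i.succ) ρ p * vcol γ n s' φ' ρ (fun i => τ i.succ) q := by
        funext q; exact ih' p q
      rw [this, lax_sum]
      exact Finset.sum_congr rfl fun _ _ => mul_comm _ _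
    rw [e, lax_sum]
    refine Finset.sum_congr rfl fun ρ _ => ?_
    rw [vcol_succ γ hγ, vcol_succ γ hγ]
    simp [Fin.consEquiv, mul_comm]

end aux

/-- The transfer matrices form a commuting family:
`[Ω(s,φ), Ω(s',φ')] = 0` for all `s, s', φ, φ' ∈ ℂ`. -/
theorem transfer_matrices_commute (γ : ℝ) (hγ : Real.sin γ ≠ 0)
    (n : ℕ) (hn : 1 ≤ n) (s s' φ φ' : ℂ) :
    Omega γ n s φ * Omega γ n s' φ' = Omega γ n s' φ' * Omega γ n s φ := by
  ext σ τ
  have h1 := vcol_TT γ hγ s s' φ φ' n σ τ 0 0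
  have h2 := vcol_TT γ hγ s' s φ' φ n σ τ 0 0
  rw [swapU, swapV, ← h2] at h1
  rw [Matrix.mul_apply, Matrix.mul_apply]
  exact h1

end
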